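/- arXiv:2512.13366 — 2 statements merged into one kernel-verified Lean document; each statement's English description precedes it below -/
import Mathlib

section
/- Let g ≥ 1, n = g+1, k ∈ {1,…,g}, let κ₁,…,κ_n ∈ ℂ be pairwise distinct, and let λ₀ = β₀ = 1 and λ₁,…,λ_g, β₁,…,β_g ∈ ℂ be nonzero. Let A be the k×n matrix with A_{ij} = δ_{ij} for j ≤ k and A_{ij} = β_{i−1}/(β_{j−1}(κ_j − κ_i)²) · ∏_{l ∈ I_k, l ≠ i}(κ_i − κ_l)/(κ_j − κ_l) for i ≤ k < j ≤ n (I_k = {1,…,k}), and let Ã be the k×n matrix with Ã_{ij} = κ_j^{i−1} λ_{j−1}. Then the row spaces of A and Ã in ℂ^n coincide (i.e. A and Ã represent the same point of the Grassmannian Gr(k,n)) if and only if β_j = λ_j^{−1} · ∏_{l ∈ {2,…,k}∖{j+1}} (κ_l − κ₁)²/(κ_l − κ_{j+1})² for 1 ≤ j ≤ k−1, and β_j = λ_j^{−1} (κ_{j+1} − κ₁)^{−2} · ∏_{l=2}^{k} (κ_l − κ₁)²/(κ_l − κ_{j+1})² for k ≤ j ≤ g. -/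
open Finset

/-- The index set `I_k = {1,…,k}` (0-indexed: the first `k` elements of `Fin n`). -/
def IkSet (k n : ℕ) : Finset (Fin n) := Finset.univ.filter (fun j => (j : ℕ) < k)

/-- The `k × n` matrix `A` of the banana Hirota parametrization (0-indexed): `A_{ij} = δ_{ij}`
on the first `k` columns, and
`A_{ij} = β_{i−1}/(β_{j−1}(κ_j − κ_i)²) · ∏_{l ∈ I_k, l ≠ i}(κ_i − κ_l)/(κ_j − κ_l)`
on the remaining columns. -/
noncomputable def bananaA {𝔽 : Type*} [Field 𝔽] (g k : ℕ) (hk : k ≤ g)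
    (κ β : Fin (g + 1) → 𝔽) : Matrix (Fin k) (Fin (g + 1)) 𝔽 :=
  Matrix.of fun i j =>
    if (j : ℕ) < k then (if (i : ℕ) = (j : ℕ) then 1 else 0)
    else
      (β (Fin.castLE (Nat.le_succ_of_le hk) i) /
          (β j * (κ j - κ (Fin.castLE (Nat.le_succ_of_le hk) i)) ^ 2)) *
        ∏ l ∈ (IkSet k (g + 1)).erase (Fin.castLE (Nat.le_succ_of_le hk) i),
          (κ (Fin.castLE (Nat.le_succ_of_le hk) i) - κ l) / (κ j - κ l)

/-- The `k × n` matrix `Ã` with `Ã_{ij} = κ_j^{i−1} λ_{j−1}` (0-indexed: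
`Ã_{ij} = κ_j^i · λ_j`). -/
noncomputable def bananaAtilde {𝔽 : Type*} [Field 𝔽] (g k : ℕ) (κ lam : Fin (g + 1) → 𝔽) :
    Matrix (Fin k) (Fin (g + 1)) 𝔽 :=
  Matrix.of fun i j => κ j ^ (i : ℕ) * lam j

open Polynomial in
noncomputable def evT {n : ℕ} (κ lam : Fin n → ℂ) : ℂ[X] →ₗ[ℂ] (Fin n → ℂ) where
  toFun p := fun j => p.eval (κ j) * lam j
  map_add' p q := by funext j; simp [add_mul]
  map_smul' c p := by funext j; simp [mul_assoc]

lemma span_tilde (g k : ℕ) (κ lam : Fin (g + 1) → ℂ) :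
    Submodule.span ℂ (Set.range fun i : Fin k => bananaAtilde g k κ lam i) =
      (Polynomial.degreeLT ℂ k).map (evT κ lam) := by
  rw [Polynomial.degreeLT_eq_span_X_pow, Submodule.map_span]
  congr 1
  ext v
  constructor
  · rintro ⟨i, rfl⟩
    refine ⟨Polynomial.X ^ (i : ℕ), ?_, ?_⟩
    · simp only [Finset.coe_image, Set.mem_image, Finset.mem_coe, Finset.mem_range]
      exact ⟨i, i.2, rfl⟩
    · funext j; simp [evT, bananaAtilde]
  · rintro ⟨p, hp, rfl⟩
    simp only [Finset.coe_image, Set.mem_image, Finset.mem_coe, Finset.mem_range] at hp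
    obtain ⟨i, hi, rfl⟩ := hp
    refine ⟨⟨i, hi⟩, ?_⟩
    funext j; simp [evT, bananaAtilde]

lemma card_Ik (g k : ℕ) (hkg : k ≤ g) : (IkSet k (g + 1)).card = k := by
  have : IkSet k (g+1) = (Finset.univ : Finset (Fin k)).map
      (Fin.castLEEmb (Nat.le_succ_of_le hkg)) := by
    ext j
    simp only [IkSet, Finset.mem_filter, Finset.mem_univ, true_and, Finset.mem_map]
    constructor
    · intro h; exact ⟨⟨j, h⟩, by ext; simp⟩
    · rintro ⟨a, rfl⟩; simp
  rw [this]; simp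

lemma mem_Ik {k n : ℕ} {j : Fin n} : j ∈ IkSet k n ↔ (j : ℕ) < k := by simp [IkSet]

lemma vanish (g k : ℕ) (hkg : k ≤ g) (κ lam : Fin (g + 1) → ℂ) (hκ : Function.Injective κ)
    (hl : ∀ j, lam j ≠ 0) (v : Fin (g + 1) → ℂ)
    (hv : v ∈ (Polynomial.degreeLT ℂ k).map (evT κ lam))
    (h0 : ∀ j : Fin (g + 1), (j : ℕ) < k → v j = 0) : v = 0 := by
  obtain ⟨p, hp, rfl⟩ := hv
  have hp' : p.degree < k := Polynomial.mem_degreeLT.1 hp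
  have : p = 0 := by
    refine Polynomial.eq_zero_of_degree_lt_of_eval_index_eq_zero (s := IkSet k (g+1)) (v := κ)
      hκ.injOn (by rwa [card_Ik g k hkg]) ?_
    intro i hi
    have := h0 i (mem_Ik.1 hi)
    simpa [evT, hl i] using this
  simp [this]

/-- normalized rows -/
noncomputable def bRow (g k : ℕ) (κ lam : Fin (g + 1) → ℂ) (i : Fin (g + 1)) :
    Fin (g + 1) → ℂ := fun j =>
  (∏ l ∈ (IkSet k (g + 1)).erase i, ((κ j - κ l) / (κ i - κ l))) * lam j / lam i

lemma bRow_mem (g k : ℕ) (hkg : k ≤ g) (κ lam : Fin (g + 1) → ℂ) (hκ : Function.Injective κ)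
    (i : Fin (g + 1)) (hi : (i : ℕ) < k) :
    bRow g k κ lam i ∈ (Polynomial.degreeLT ℂ k).map (evT κ lam) := by
  refine ⟨(lam i)⁻¹ • Lagrange.basis (IkSet k (g+1)) κ i, ?_, ?_⟩
  · refine Submodule.smul_mem _ _ ?_
    rw [Polynomial.mem_degreeLT, Lagrange.degree_basis hκ.injOn (mem_Ik.2 hi), card_Ik g k hkg]
    exact_mod_cast (by omega : k - 1 < k)
  · funext j
    simp only [evT, bRow, LinearMap.coe_mk, AddHom.coe_mk, Lagrange.basis, Polynomial.eval_smul,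
      Polynomial.eval_prod, Lagrange.basisDivisor, Polynomial.eval_mul, Polynomial.eval_C,
      Polynomial.eval_sub, Polynomial.eval_X, smul_eq_mul]
    rw [Finset.prod_congr rfl (fun l _ => (inv_mul_eq_div (κ i - κ l) (κ j - κ l)))]
    ring

lemma bRow_lt (g k : ℕ) (κ lam : Fin (g + 1) → ℂ) (hκ : Function.Injective κ)
    (hl : ∀ j, lam j ≠ 0)
    (i j : Fin (g + 1)) (hj : (j : ℕ) < k) :
    bRow g k κ lam i j = if i = j then 1 else 0 := by
  unfold bRow
  split_ifs with h
  · subst h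
    rw [Finset.prod_eq_one, one_mul, div_self (hl i)]
    intro l hl
    refine div_self (sub_ne_zero.2 fun h => ?_)
    exact (Finset.mem_erase.1 hl).1 (hκ h).symm
  · rw [Finset.prod_eq_zero (i := j)]
    · simp
    · exact Finset.mem_erase.2 ⟨fun h' => h h'.symm, mem_Ik.2 hj⟩
    · simp

lemma span_iff (g k : ℕ) (hkg : k ≤ g) (κ β lam : Fin (g + 1) → ℂ)
    (hκ : Function.Injective κ) (hl : ∀ j, lam j ≠ 0) :
    Submodule.span ℂ (Set.range fun i : Fin k => bananaA g k hkg κ β i) =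
      Submodule.span ℂ (Set.range fun i : Fin k => bananaAtilde g k κ lam i) ↔
    ∀ i : Fin k, bananaA g k hkg κ β i =
      bRow g k κ lam (Fin.castLE (Nat.le_succ_of_le hkg) i) := by
  rw [span_tilde]
  have hA : ∀ (i : Fin k) (j : Fin (g+1)), (j : ℕ) < k → bananaA g k hkg κ β i j =
      if (i : ℕ) = (j : ℕ) then 1 else 0 := by
    intro i j hj; simp [bananaA, hj]
  constructor
  · intro h i
    rw [← sub_eq_zero]
    refine vanish g k hkg κ lam hκ hl _ ?_ ?_
    · refine Submodule.sub_mem _ ?_ (bRow_mem g k hkg κ lam hκ _ (by simp))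
      rw [← h]
      exact Submodule.subset_span ⟨i, rfl⟩
    · intro j hj
      rw [Pi.sub_apply, hA i j hj, bRow_lt g k κ lam hκ hl _ j hj]
      simp [Fin.ext_iff]
  · intro h
    have hle : Submodule.span ℂ (Set.range fun i : Fin k => bananaA g k hkg κ β i) ≤
        (Polynomial.degreeLT ℂ k).map (evT κ lam) := by
      rw [Submodule.span_le]
      rintro _ ⟨i, rfl⟩
      simp only [SetLike.mem_coe]
      rw [h i]
      exact bRow_mem g k hkg κ lam hκ _ (by simp)
    refine le_antisymm hle ?_
    intro v hv
    have hw : (∑ i : Fin k, v (Fin.castLE (Nat.le_succ_of_le hkg) i) • bananaA g k hkg κ β i) ∈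
        Submodule.span ℂ (Set.range fun i : Fin k => bananaA g k hkg κ β i) :=
      Submodule.sum_mem _ fun i _ => Submodule.smul_mem _ _ (Submodule.subset_span ⟨i, rfl⟩)
    have : v - (∑ i : Fin k, v (Fin.castLE (Nat.le_succ_of_le hkg) i) • bananaA g k hkg κ β i)
        = 0 := by
      refine vanish g k hkg κ lam hκ hl _ (Submodule.sub_mem _ hv (hle hw)) ?_
      intro j hj
      rw [Pi.sub_apply, Finset.sum_apply, Finset.sum_eq_single ⟨j, hj⟩]
      · rw [Pi.smul_apply, hA _ j hj]; simp
      · intro b _ hb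
        rw [Pi.smul_apply, hA _ j hj, if_neg]
        · simp
        · intro h'; exact hb (Fin.ext h')
      · simp
    rw [sub_eq_zero.1 this]
    exact hw

lemma prod_ne {n : ℕ} (κ : Fin n → ℂ) (hκ : Function.Injective κ) (s : Finset (Fin n)) (i : Fin n)
    (hi : i ∉ s) : ∏ l ∈ s, (κ i - κ l) ≠ 0 := by
  rw [Finset.prod_ne_zero_iff]
  intro l hl
  refine sub_ne_zero.2 fun h => hi ?_
  rwa [hκ h]

lemma prod_sq {n : ℕ} (κ : Fin n → ℂ) (s : Finset (Fin n)) (i j : Fin n) :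
    ∏ l ∈ s, (κ l - κ i) ^ 2 / (κ l - κ j) ^ 2 =
      (∏ l ∈ s, (κ i - κ l)) ^ 2 / (∏ l ∈ s, (κ j - κ l)) ^ 2 := by
  rw [← Finset.prod_pow, ← Finset.prod_pow, ← Finset.prod_div_distrib]
  refine Finset.prod_congr rfl fun l _ => ?_
  rw [← neg_sub (κ l) (κ i), ← neg_sub (κ l) (κ j), neg_sq, neg_sq]

/-- `A` and `Ã` have the same row space in `ℂ^n` (represent the same point of `Gr(k,n)`)
iff `β_j = λ_j⁻¹ ∏_{l ∈ {2,…,k}∖{j+1}} (κ_l−κ₁)²/(κ_l−κ_{j+1})²` for `1 ≤ j ≤ k−1` and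
`β_j = λ_j⁻¹ (κ_{j+1}−κ₁)⁻² ∏_{l=2}^{k} (κ_l−κ₁)²/(κ_l−κ_{j+1})²` for `k ≤ j ≤ g`
(indices of `κ` written 1-indexed; 0-indexed `κ_{j+1} = κ j`, `κ₁ = κ 0`,
`{2,…,k} = {l : 1 ≤ l < k}`). -/
theorem stmt17 (g k : ℕ) (hg : 1 ≤ g) (hk1 : 1 ≤ k) (hkg : k ≤ g)
    (κ β lam : Fin (g + 1) → ℂ) (hκ : Function.Injective κ)
    (hβ0 : β 0 = 1) (hlam0 : lam 0 = 1)
    (hβ : ∀ j : Fin (g + 1), j ≠ 0 → β j ≠ 0) (hlam : ∀ j : Fin (g + 1), j ≠ 0 → lam j ≠ 0) :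
    Submodule.span ℂ (Set.range fun i : Fin k => bananaA g k hkg κ β i) =
      Submodule.span ℂ (Set.range fun i : Fin k => bananaAtilde g k κ lam i) ↔
    ((∀ j : Fin (g + 1), 1 ≤ (j : ℕ) → (j : ℕ) ≤ k - 1 →
        β j = (lam j)⁻¹ *
          ∏ l ∈ (Finset.univ.filter
              (fun l : Fin (g + 1) => 1 ≤ (l : ℕ) ∧ (l : ℕ) < k)).erase j,
            (κ l - κ 0) ^ 2 / (κ l - κ j) ^ 2) ∧
      ∀ j : Fin (g + 1), k ≤ (j : ℕ) →
        β j = (lam j)⁻¹ * ((κ j - κ 0) ^ 2)⁻¹ *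
          ∏ l ∈ Finset.univ.filter (fun l : Fin (g + 1) => 1 ≤ (l : ℕ) ∧ (l : ℕ) < k),
            (κ l - κ 0) ^ 2 / (κ l - κ j) ^ 2) := by
  have hl : ∀ j, lam j ≠ 0 := fun j => by
    by_cases h : j = 0
    · simp [h, hlam0]
    · exact hlam j h
  have hb : ∀ j, β j ≠ 0 := fun j => by
    by_cases h : j = 0
    · simp [h, hβ0]
    · exact hβ j h
  rw [span_iff g k hkg κ β lam hκ hl]
  set S := IkSet k (g + 1) with hS
  have hF : Finset.univ.filter (fun l : Fin (g + 1) => 1 ≤ (l : ℕ) ∧ (l : ℕ) < k) = S.erase 0 := by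
    ext l
    rw [Finset.mem_erase, hS, mem_Ik, Finset.mem_filter, ne_eq, Fin.ext_iff, Fin.val_zero]
    simp only [Finset.mem_univ, true_and]
    omega
  rw [hF]
  have h0S : (0 : Fin (g + 1)) ∈ S := by rw [hS, mem_Ik]; simpa using (show 0 < k by omega)
  have hsub : ∀ i j : Fin (g+1), i ≠ j → κ i - κ j ≠ 0 := fun i j h =>
    sub_ne_zero.2 fun h' => h (hκ h')
  -- step 1
  have s1 : (∀ i : Fin k, bananaA g k hkg κ β i =
      bRow g k κ lam (Fin.castLE (Nat.le_succ_of_le hkg) i)) ↔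
      ∀ i j : Fin (g + 1), i ∈ S → j ∉ S →
        β i * lam i * (∏ l ∈ S.erase i, (κ i - κ l)) ^ 2 =
          β j * lam j * (∏ l ∈ S, (κ j - κ l)) ^ 2 := by
    have key : ∀ i j : Fin (g + 1), i ∈ S → j ∉ S →
        ((β i / (β j * (κ j - κ i) ^ 2)) * ∏ l ∈ S.erase i, (κ i - κ l) / (κ j - κ l) =
          bRow g k κ lam i j ↔ β i * lam i * (∏ l ∈ S.erase i, (κ i - κ l)) ^ 2 =
          β j * lam j * (∏ l ∈ S, (κ j - κ l)) ^ 2) := by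
      intro i j hi hj
      have hij : j ≠ i := fun h => hj (h ▸ hi)
      have h1 := hsub j i hij
      have h2 := prod_ne κ hκ (S.erase i) i (by simp)
      have h3 := prod_ne κ hκ (S.erase i) j (fun h => hj (Finset.mem_of_mem_erase h))
      have h4 := hl i
      have h5 := hb j
      unfold bRow
      rw [← hS, Finset.prod_div_distrib, Finset.prod_div_distrib, ← Finset.mul_prod_erase S _ hi]
      generalize (∏ l ∈ S.erase i, (κ i - κ l)) = P at *
      generalize (∏ l ∈ S.erase i, (κ j - κ l)) = Q at *
      generalize κ j - κ i = d at *
      rw [div_mul_div_comm, div_mul_eq_mul_div, div_div, div_eq_div_iff (by positivity) (by positivity)]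
      constructor <;> intro h <;> linear_combination h
    constructor
    · intro h i j hi hj
      rw [← key i j hi hj]
      have := congrFun (h ⟨i, mem_Ik.1 hi⟩) j
      have hj' : ¬ (j : ℕ) < k := fun h => hj (mem_Ik.2 h)
      simpa [bananaA, hj'] using this
    · intro h i
      funext j
      by_cases hj : (j : ℕ) < k
      · rw [bRow_lt g k κ lam hκ hl _ j hj]
        simp [bananaA, hj, Fin.ext_iff]
      · have := (key (Fin.castLE (Nat.le_succ_of_le hkg) i) j (mem_Ik.2 (by simp))
          (fun h => hj (mem_Ik.1 h))).2 (h _ _ (mem_Ik.2 (by simp)) (fun h => hj (mem_Ik.1 h)))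
        rw [← this]
        simp [bananaA, hj, hS]
  rw [s1]
  have c1 : ∀ j : Fin (g + 1), j ∈ S → j ≠ 0 →
      (β j = (lam j)⁻¹ * ∏ l ∈ (S.erase 0).erase j, (κ l - κ 0) ^ 2 / (κ l - κ j) ^ 2 ↔
        β j * lam j * (∏ l ∈ S.erase j, (κ j - κ l)) ^ 2 =
          (∏ l ∈ S.erase 0, (κ 0 - κ l)) ^ 2) := by
    intro j hj hj0
    rw [prod_sq, ← Finset.mul_prod_erase (S.erase 0) _ (Finset.mem_erase.2 ⟨hj0, hj⟩),
      ← Finset.mul_prod_erase (S.erase j) _ (Finset.mem_erase.2 ⟨hj0.symm, h0S⟩),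
      Finset.erase_right_comm (a := j)]
    have h3 := prod_ne κ hκ ((S.erase 0).erase j) j (by simp)
    have h1 := hsub j 0 hj0
    have h4 := hl j
    generalize (∏ l ∈ (S.erase 0).erase j, (κ j - κ l)) = P at *
    generalize (∏ l ∈ (S.erase 0).erase j, (κ 0 - κ l)) = Q at *
    rw [← neg_sub (κ j) (κ 0)]
    generalize κ j - κ 0 = d at *
    rw [inv_mul_eq_div, div_div, eq_div_iff (by positivity)]
    have hd : d ^ 2 ≠ 0 := pow_ne_zero 2 h1
    constructor
    · intro h; linear_combination d ^ 2 * h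
    · intro h; apply mul_left_cancel₀ hd; linear_combination h
  have c2 : ∀ j : Fin (g + 1), j ∉ S →
      (β j = (lam j)⁻¹ * ((κ j - κ 0) ^ 2)⁻¹ *
          ∏ l ∈ S.erase 0, (κ l - κ 0) ^ 2 / (κ l - κ j) ^ 2 ↔
        β j * lam j * (∏ l ∈ S, (κ j - κ l)) ^ 2 =
          (∏ l ∈ S.erase 0, (κ 0 - κ l)) ^ 2) := by
    intro j hj
    have hj0 : j ≠ 0 := fun h => hj (h ▸ h0S)
    rw [prod_sq, ← Finset.mul_prod_erase S _ h0S]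
    have h3 := prod_ne κ hκ (S.erase 0) j (fun h => hj (Finset.mem_of_mem_erase h))
    have h1 := hsub j 0 hj0
    have h4 := hl j
    generalize (∏ l ∈ S.erase 0, (κ j - κ l)) = P at *
    generalize (∏ l ∈ S.erase 0, (κ 0 - κ l)) = Q at *
    generalize κ j - κ 0 = d at *
    rw [← mul_inv, inv_mul_eq_div, div_div, eq_div_iff (by positivity)]
    constructor <;> intro h <;> linear_combination h
  have hgS : Fin.last g ∉ S := by rw [hS, mem_Ik]; simpa using hkg
  constructor
  · intro h
    have e : ∀ j, j ∉ S → β j * lam j * (∏ l ∈ S, (κ j - κ l)) ^ 2 =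
          (∏ l ∈ S.erase 0, (κ 0 - κ l)) ^ 2 := by
      intro j hj
      rw [← h 0 j h0S hj, hβ0, hlam0]; ring
    refine ⟨fun j hj1 hj2 => ?_, fun j hj => ?_⟩
    · have hj : j ∈ S := mem_Ik.2 (by omega)
      refine (c1 j hj (by rintro rfl; simp at hj1)).2 ?_
      rw [h j _ hj hgS, e _ hgS]
    · have hj : j ∉ S := fun h => by have := mem_Ik.1 h; omega
      exact (c2 j hj).2 (e j hj)
  · rintro ⟨ha, hb'⟩ i j hi hj
    have hjk : k ≤ (j : ℕ) := by
      by_contra hc; exact hj (mem_Ik.2 (by omega))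
    rw [(c2 j hj).1 (hb' j hjk)]
    by_cases hi0 : i = 0
    · subst hi0; rw [hβ0, hlam0]; ring
    · have := mem_Ik.1 hi
      have h0 : (i : ℕ) ≠ 0 := fun h => hi0 (Fin.ext (by simpa using h))
      exact (c1 i hi hi0).1 (ha i (by omega) (by omega))
end

section
/- Let n ≥ 2 and 1 ≤ k ≤ n−1, and let V = {x ∈ {0,1}^n : x₁ + ⋯ + x_n = k} be the vertex set of the hypersimplex Δ_{k,n}. Then: (i) {u + v : u, v ∈ V, u ≠ v} equals the set of vectors Σ_{i∈I} e_i + 2·Σ_{j∈J} e_j where d ranges over {0,…,k−1}, J ⊆ {1,…,n} with |J| = d, I ⊆ {1,…,n} with |I| = 2k−2d and I ∩ J = ∅; (ii) for each such vector p having exactly d coordinates equal to 2, the number of unordered pairs {u, v} ⊆ V with u ≠ v and u + v = p equals (1/2)·C(2k−2d, k−d); (iii) the number of such vectors with exactly d coordinates equal to 2 is C(n, d)·C(n−d, 2k−2d). -/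
open Finset

/-- The vertex set of the hypersimplex `Δ_{k,n}`: 0/1-vectors in `ℝ^n` with exactly `k`
coordinates equal to `1` (equivalently, with coordinate sum `k`). -/
def hyperVert (n k : ℕ) : Set (Fin n → ℝ) :=
  {x | (∀ i, x i = 0 ∨ x i = 1) ∧ ∑ i, x i = k}

/-- The set `Δ_{k,n}^{[2]}` of sums of two distinct vertices of `Δ_{k,n}`. -/
def sumTwoDistinct (n k : ℕ) : Set (Fin n → ℝ) :=
  {p | ∃ u ∈ hyperVert n k, ∃ v ∈ hyperVert n k, u ≠ v ∧ p = u + v}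


def indF {n : ℕ} (A : Finset (Fin n)) : Fin n → ℝ := fun m => if m ∈ A then 1 else 0

def vecF {n : ℕ} (I J : Finset (Fin n)) : Fin n → ℝ :=
  fun m => (if m ∈ I then (1 : ℝ) else 0) + 2 * (if m ∈ J then 1 else 0)

lemma indF_inj {n : ℕ} {A B : Finset (Fin n)} : indF A = indF B ↔ A = B := by
  refine ⟨fun h => ?_, fun h => by rw [h]⟩
  ext m
  have := congrFun h m
  by_cases h1 : m ∈ A <;> by_cases h2 : m ∈ B <;> simp_all [indF]

lemma mem_hv {n k : ℕ} {u : Fin n → ℝ} :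
    u ∈ hyperVert n k ↔ ∃ A : Finset (Fin n), A.card = k ∧ u = indF A := by
  constructor
  · rintro ⟨h1, h2⟩
    have hu : u = indF (univ.filter (fun m => u m = 1)) := by
      funext m
      rcases h1 m with h | h <;> simp [indF, h]
    refine ⟨_, ?_, hu⟩
    rw [hu] at h2
    simp only [indF, Finset.sum_ite_mem, Finset.univ_inter, Finset.sum_const, nsmul_eq_mul,
      mul_one] at h2
    exact_mod_cast h2
  · rintro ⟨A, hA, rfl⟩
    refine ⟨fun i => ?_, ?_⟩
    · by_cases h : i ∈ A <;> simp [indF, h]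
    · simp [indF, hA]

lemma vecF_two {n : ℕ} {I J : Finset (Fin n)} (h : Disjoint I J) :
    {m | vecF I J m = 2} = (J : Set (Fin n)) := by
  ext m
  have := fun q : m ∈ _ => Finset.disjoint_left.1 h q
  by_cases h1 : m ∈ I <;> by_cases h2 : m ∈ J <;> simp_all [vecF]

lemma vecF_one {n : ℕ} {I J : Finset (Fin n)} (h : Disjoint I J) :
    {m | vecF I J m = 1} = (I : Set (Fin n)) := by
  ext m
  have := fun q : m ∈ _ => Finset.disjoint_left.1 h q
  by_cases h1 : m ∈ I <;> by_cases h2 : m ∈ J <;> simp_all [vecF]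

lemma vecF_inj {n : ℕ} {I J I' J' : Finset (Fin n)} (h : Disjoint I J) (h' : Disjoint I' J')
    (e : vecF I J = vecF I' J') : I = I' ∧ J = J' := by
  constructor
  · apply Finset.coe_injective
    rw [← vecF_one h, ← vecF_one h', e]
  · apply Finset.coe_injective
    rw [← vecF_two h, ← vecF_two h', e]

lemma ind_add {n : ℕ} (A B : Finset (Fin n)) :
    indF A + indF B = vecF ((A \ B) ∪ (B \ A)) (A ∩ B) := by
  funext m
  by_cases h1 : m ∈ A <;> by_cases h2 : m ∈ B <;> simp [indF, vecF, h1, h2]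
  norm_num

lemma disj_ab {n : ℕ} (A B : Finset (Fin n)) : Disjoint ((A \ B) ∪ (B \ A)) (A ∩ B) := by
  rw [Finset.disjoint_left]
  intro a
  simp only [Finset.mem_union, Finset.mem_sdiff, Finset.mem_inter]
  tauto

lemma card_ab {n k : ℕ} {A B : Finset (Fin n)} (hA : A.card = k) (hB : B.card = k) (h : A ≠ B) :
    (A ∩ B).card < k ∧ ((A \ B) ∪ (B \ A)).card = 2 * k - 2 * (A ∩ B).card := by
  have h1 : (A ∩ B).card < k := by
    by_contra hc
    have e1 : A ∩ B = A := Finset.eq_of_subset_of_card_le Finset.inter_subset_left (by omega)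
    have e2 : A ∩ B = B := Finset.eq_of_subset_of_card_le Finset.inter_subset_right (by omega)
    exact h (e1.symm.trans e2)
  refine ⟨h1, ?_⟩
  rw [Finset.card_union_of_disjoint]
  · have := Finset.card_sdiff_add_card_inter A B
    have := Finset.card_sdiff_add_card_inter B A
    rw [Finset.inter_comm B A] at this
    omega
  · rw [Finset.disjoint_left]
    intro a
    simp only [Finset.mem_sdiff]
    tauto

/-- splitting -/
lemma split {n : ℕ} {I J S : Finset (Fin n)} (h : Disjoint I J) (hS : S ⊆ I) :
    indF (J ∪ S) + indF (J ∪ (I \ S)) = vecF I J := by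
  funext m
  have h1 := fun q : m ∈ _ => Finset.disjoint_left.1 h q
  have h2 := @hS m
  by_cases a : m ∈ I <;> by_cases b : m ∈ J <;> by_cases c : m ∈ S <;>
    simp_all [indF, vecF]
  norm_num

lemma split_card {n k d : ℕ} {I J S : Finset (Fin n)} (h : Disjoint I J) (hS : S ⊆ I) (hd : d < k)
    (hJ : J.card = d) (hI : I.card = 2 * k - 2 * d) (hc : S.card = k - d) :
    (J ∪ S).card = k ∧ (J ∪ (I \ S)).card = k ∧ J ∪ S ≠ J ∪ (I \ S) := by
  have d1 : Disjoint J S := (h.mono_left hS).symm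
  have d2 : Disjoint J (I \ S) := (h.mono_left Finset.sdiff_subset).symm
  refine ⟨?_, ?_, ?_⟩
  · rw [Finset.card_union_of_disjoint d1]; omega
  · rw [Finset.card_union_of_disjoint d2, Finset.card_sdiff_of_subset hS]; omega
  · intro e
    obtain ⟨x, hx⟩ : S.Nonempty := Finset.card_pos.1 (by omega)
    have h3 : x ∈ J ∪ (I \ S) := e ▸ Finset.mem_union_right J hx
    have := Finset.disjoint_right.1 d1 hx
    simp_all

lemma union_cancel {n : ℕ} {J S T : Finset (Fin n)} (hS : Disjoint J S) (hT : Disjoint J T)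
    (e : J ∪ S = J ∪ T) : S = T := by
  ext m
  have h1 := fun q : m ∈ _ => Finset.disjoint_left.1 hS q
  have h2 := fun q : m ∈ _ => Finset.disjoint_left.1 hT q
  have h3 := Finset.ext_iff.1 e m
  simp only [Finset.mem_union] at h3
  tauto

lemma part1 (n k : ℕ) : sumTwoDistinct n k =
      {p : Fin n → ℝ | ∃ d : ℕ, d < k ∧ ∃ I J : Finset (Fin n),
        J.card = d ∧ I.card = 2 * k - 2 * d ∧ Disjoint I J ∧ p = vecF I J} := by
  ext p
  constructor
  · rintro ⟨u, hu, v, hv, huv, rfl⟩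
    obtain ⟨A, hA, rfl⟩ := mem_hv.1 hu
    obtain ⟨B, hB, rfl⟩ := mem_hv.1 hv
    have hAB : A ≠ B := fun h => huv (by rw [h])
    obtain ⟨h1, h2⟩ := card_ab hA hB hAB
    exact ⟨_, h1, _, _, rfl, h2, disj_ab A B, ind_add A B⟩
  · rintro ⟨d, hd, I, J, hJ, hI, hdis, rfl⟩
    obtain ⟨S, hS, hc⟩ := Finset.exists_subset_card_eq (s := I) (n := k - d) (by omega)
    obtain ⟨a, b, c⟩ := split_card hdis hS hd hJ hI hc
    exact ⟨_, mem_hv.2 ⟨_, a, rfl⟩, _, mem_hv.2 ⟨_, b, rfl⟩, fun h => c (indF_inj.1 h),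
      (split hdis hS).symm⟩

open Classical in
lemma part2 (n k d : ℕ) (hd : d < k) (I J : Finset (Fin n)) (hJ : J.card = d)
    (hI : I.card = 2 * k - 2 * d) (hdis : Disjoint I J) :
    2 * {s : Set (Fin n → ℝ) | ∃ u ∈ hyperVert n k, ∃ v ∈ hyperVert n k,
            u ≠ v ∧ u + v = vecF I J ∧ s = {u, v}}.ncard =
        Nat.choose (2 * k - 2 * d) (k - d) := by
  set f : Finset (Fin n) → Set (Fin n → ℝ) :=
    fun S => {indF (J ∪ S), indF (J ∪ (I \ S))} with hf
  have hset : {s : Set (Fin n → ℝ) | ∃ u ∈ hyperVert n k, ∃ v ∈ hyperVert n k,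
            u ≠ v ∧ u + v = vecF I J ∧ s = {u, v}} =
      (((powersetCard (k - d) I).image f : Finset _) : Set (Set (Fin n → ℝ))) := by
    ext s
    simp only [Set.mem_setOf_eq, Finset.coe_image, Set.mem_image, Finset.mem_coe,
      Finset.mem_powersetCard]
    constructor
    · rintro ⟨u, hu, v, hv, huv, hp, rfl⟩
      obtain ⟨A, hA, rfl⟩ := mem_hv.1 hu
      obtain ⟨B, hB, rfl⟩ := mem_hv.1 hv
      rw [ind_add] at hp
      obtain ⟨e1, e2⟩ := vecF_inj (disj_ab A B) hdis hp
      refine ⟨A \ B, ⟨?_, ?_⟩, ?_⟩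
      · rw [← e1]; exact Finset.subset_union_left
      · have := Finset.card_sdiff_add_card_inter A B
        rw [e2] at this
        omega
      · have a1 : J ∪ (A \ B) = A := by
          rw [← e2]; ext m; simp only [Finset.mem_union, Finset.mem_inter, Finset.mem_sdiff]; tauto
        have a2 : J ∪ (I \ (A \ B)) = B := by
          rw [← e2, ← e1]; ext m
          simp only [Finset.mem_union, Finset.mem_inter, Finset.mem_sdiff]; tauto
        simp only [hf, a1, a2]
    · rintro ⟨S, ⟨hS, hc⟩, rfl⟩
      obtain ⟨a, b, c⟩ := split_card hdis hS hd hJ hI hc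
      exact ⟨_, mem_hv.2 ⟨_, a, rfl⟩, _, mem_hv.2 ⟨_, b, rfl⟩, fun h => c (indF_inj.1 h),
        split hdis hS, rfl⟩
  rw [hset, Set.ncard_coe_finset, ← hI, ← Finset.card_powersetCard,
    Finset.card_eq_sum_card_image f (powersetCard (k - d) I)]
  rw [Finset.sum_const_nat (m := 2), mul_comm]
  intro s hs
  obtain ⟨S, hS, rfl⟩ := Finset.mem_image.1 hs
  obtain ⟨hS, hc⟩ := Finset.mem_powersetCard.1 hS
  have key : (powersetCard (k - d) I).filter (fun T => f T = f S) = {S, I \ S} := by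
    ext T
    simp only [Finset.mem_filter, Finset.mem_powersetCard, Finset.mem_insert,
      Finset.mem_singleton]
    have d1 : ∀ S, S ⊆ I → Disjoint J S := fun S hS => (hdis.mono_left hS).symm
    constructor
    · rintro ⟨⟨hT, hTc⟩, e⟩
      have : indF (J ∪ T) ∈ f S := by rw [← e]; simp [hf]
      simp only [hf, Set.mem_insert_iff, Set.mem_singleton_iff, indF_inj] at this
      rcases this with h | h
      · exact Or.inl (union_cancel (d1 _ hT) (d1 _ hS) h)
      · exact Or.inr (union_cancel (d1 _ hT) (d1 _ Finset.sdiff_subset) h)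
    · rintro (rfl | rfl)
      · exact ⟨⟨hS, hc⟩, rfl⟩
      · refine ⟨⟨Finset.sdiff_subset, ?_⟩, ?_⟩
        · rw [Finset.card_sdiff_of_subset hS]; omega
        · simp only [hf, Finset.sdiff_sdiff_eq_self hS]
          exact Set.pair_comm _ _
  rw [key, Finset.card_pair]
  intro e
  exact (split_card hdis hS hd hJ hI hc).2.2 (congrArg (J ∪ ·) e)

lemma part3 (n k d : ℕ) (hd : d < k) :
    {p | p ∈ sumTwoDistinct n k ∧ {m | p m = 2}.ncard = d}.ncard =
        Nat.choose n d * Nat.choose (n - d) (2 * k - 2 * d) := by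
  set P : Finset ((_ : Finset (Fin n)) × Finset (Fin n)) :=
    (powersetCard d (univ : Finset (Fin n))).sigma (fun J => powersetCard (2 * k - 2 * d) Jᶜ)
    with hP
  have mP : ∀ x, x ∈ P ↔ x.1.card = d ∧ Disjoint x.2 x.1 ∧ x.2.card = 2 * k - 2 * d := by
    intro x
    simp [hP, Finset.mem_sigma, Finset.mem_powersetCard, Finset.subset_compl_iff_disjoint_right]
  have hset : {p | p ∈ sumTwoDistinct n k ∧ {m | p m = 2}.ncard = d} =
      (fun x : ((_ : Finset (Fin n)) × Finset (Fin n)) => vecF x.2 x.1) '' (P : Set _) := by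
    ext p
    rw [part1]
    simp only [Set.mem_setOf_eq, Set.mem_image, Finset.mem_coe, mP]
    constructor
    · rintro ⟨⟨d', hd', I, J, hJ, hI, hdis, rfl⟩, h2⟩
      rw [vecF_two hdis, Set.ncard_coe_finset] at h2
      obtain rfl : d' = d := by omega
      exact ⟨⟨J, I⟩, ⟨hJ, hdis, hI⟩, rfl⟩
    · rintro ⟨⟨J, I⟩, ⟨hJ, hdis, hI⟩, rfl⟩
      refine ⟨⟨d, hd, I, J, hJ, hI, hdis, rfl⟩, ?_⟩
      simp only [vecF_two hdis, Set.ncard_coe_finset]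
      exact hJ
  rw [hset, Set.ncard_image_of_injOn, Set.ncard_coe_finset, hP, Finset.card_sigma,
    Finset.sum_const_nat (m := Nat.choose (n - d) (2 * k - 2 * d))]
  · simp
  · intro J hJ
    rw [Finset.card_powersetCard, Finset.card_compl, (Finset.mem_powersetCard.1 hJ).2,
      Fintype.card_fin]
  · rintro ⟨J, I⟩ hx ⟨J', I'⟩ hy e
    obtain ⟨_, a, _⟩ := (mP _).1 hx
    obtain ⟨_, b, _⟩ := (mP _).1 hy
    obtain ⟨rfl, rfl⟩ := vecF_inj a b e
    rfl

/-- (i) `Δ_{k,n}^{[2]}` consists of the vectors `Σ_{i∈I} e_i + 2Σ_{j∈J} e_j` with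
`|J| = d ≤ k−1`, `|I| = 2k−2d` and `I ∩ J = ∅`;
(ii) each such vector with exactly `d` coordinates equal to `2` is the sum of exactly
`(1/2)·C(2k−2d, k−d)` unordered pairs of distinct vertices;
(iii) there are `C(n,d)·C(n−d, 2k−2d)` such vectors with exactly `d` coordinates equal
to `2`. -/
theorem stmt18 (n k : ℕ) (hn : 2 ≤ n) (hk1 : 1 ≤ k) (hk : k ≤ n - 1) :
    (sumTwoDistinct n k =
      {p : Fin n → ℝ | ∃ d : ℕ, d < k ∧ ∃ I J : Finset (Fin n),
        J.card = d ∧ I.card = 2 * k - 2 * d ∧ Disjoint I J ∧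
        p = fun m => (if m ∈ I then (1 : ℝ) else 0) + 2 * (if m ∈ J then 1 else 0)}) ∧
    (∀ d : ℕ, d < k → ∀ p ∈ sumTwoDistinct n k, {m | p m = 2}.ncard = d →
      2 * {s : Set (Fin n → ℝ) | ∃ u ∈ hyperVert n k, ∃ v ∈ hyperVert n k,
            u ≠ v ∧ u + v = p ∧ s = {u, v}}.ncard =
        Nat.choose (2 * k - 2 * d) (k - d)) ∧
    (∀ d : ℕ, d < k →
      {p | p ∈ sumTwoDistinct n k ∧ {m | p m = 2}.ncard = d}.ncard =
        Nat.choose n d * Nat.choose (n - d) (2 * k - 2 * d)) := by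
  refine ⟨part1 n k, ?_, fun d hd => part3 n k d hd⟩
  intro d hd p hp h2
  rw [part1] at hp
  obtain ⟨d', hd', I, J, hJ, hI, hdis, rfl⟩ := hp
  rw [vecF_two hdis, Set.ncard_coe_finset] at h2
  obtain rfl : d' = d := by omega
  exact part2 n k d' hd I J hJ hI hdis
end
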